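/- Let w ∈ (0,∞)^d and define v ∈ (0,∞)^d by v_k = 1/(p′(λ_k)²·w_k) for each k. Then f(λ, v) = (f(λ, w))^F; that is, for all i,j ∈ {1,…,d}, the (i,j) entry of f(λ,v) equals the (d+1−j, d+1−i) entry of f(λ,w). -/

import Mathlib

noncomputable section
open Polynomial Filter Topology ENNReal

/-- The inner product `⟨p,q⟩_v = ∑ₖ p(μₖ)q(μₖ)vₖ`. -/
def ip {m : ℕ} (μ v : Fin m → ℝ) (p q : ℝ[X]) : ℝ :=
  ∑ k, p.eval (μ k) * q.eval (μ k) * v k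

/-- Pair `(pₙ, pₙ₋₁)` of monic orthogonal polynomials (with `p₋₁ = 0`). -/
def opAux {m : ℕ} (μ v : Fin m → ℝ) : ℕ → ℝ[X] × ℝ[X]
  | 0 => (1, 0)
  | n + 1 =>
    let P := opAux μ v n
    ((X - C (ip μ v P.1 (X * P.1) / ip μ v P.1 P.1)) * P.1
        - C (ip μ v P.1 P.1 / ip μ v P.2 P.2) * P.2, P.1)

/-- The `n`-th monic orthogonal polynomial of the recursion. -/
def op {m : ℕ} (μ v : Fin m → ℝ) (n : ℕ) : ℝ[X] := (opAux μ v n).1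

/-- The entry `a_N` of the Jacobi matrix construction: for odd `N = 2n+1` the diagonal
entry `a_{2n+1} = ⟨pₙ, Xpₙ⟩/⟨pₙ,pₙ⟩`, for even `N = 2n` the off-diagonal entry
`a_{2n} = √(⟨pₙ,pₙ⟩/⟨pₙ₋₁,pₙ₋₁⟩)`. -/
def fEnt {m : ℕ} (μ v : Fin m → ℝ) (N : ℕ) : ℝ :=
  if N % 2 = 1 then
    ip μ v (op μ v (N / 2)) (X * op μ v (N / 2)) / ip μ v (op μ v (N / 2)) (op μ v (N / 2))
  else
    Real.sqrt (ip μ v (op μ v (N / 2)) (op μ v (N / 2)) /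
      ip μ v (op μ v (N / 2 - 1)) (op μ v (N / 2 - 1)))

/-- The symmetric tridiagonal matrix `f(μ, v)` with diagonal `a₁,a₃,…` and
sub/super-diagonal `a₂,a₄,…`. -/
def Jmat {m : ℕ} (μ v : Fin m → ℝ) : Matrix (Fin m) (Fin m) ℝ :=
  Matrix.of fun i j =>
    if i = j then fEnt μ v (2 * (i : ℕ) + 1)
    else if (i : ℕ) + 1 = (j : ℕ) ∨ (j : ℕ) + 1 = (i : ℕ) then fEnt μ v ((i : ℕ) + (j : ℕ) + 1)
    else 0

/-- Restriction of `g : Fin d → ℝ` to a subset `Q`, reindexed in increasing order. -/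
def restr {d : ℕ} (Q : Finset (Fin d)) (g : Fin d → ℝ) : Fin Q.card → ℝ :=
  fun k => g ((Q.orderIsoOfFin rfl) k).1

/-- Leading `i × i` principal submatrix. -/
def leadSub {d : ℕ} (J : Matrix (Fin d) (Fin d) ℝ) (i : ℕ) (h : i ≤ d) :
    Matrix (Fin i) (Fin i) ℝ :=
  Matrix.of fun a b => J ⟨a.1, lt_of_lt_of_le a.2 h⟩ ⟨b.1, lt_of_lt_of_le b.2 h⟩

/-- A sequence of positive weight vectors is stable if all pairwise ratios converge
in `[0,∞]`. -/
def Stable {d : ℕ} (w : ℕ → Fin d → ℝ) : Prop :=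
  (∀ n i, 0 < w n i) ∧
    ∀ i j : Fin d, ∃ L : ℝ≥0∞,
      Tendsto (fun n => ENNReal.ofReal (w n i / w n j)) atTop (𝓝 L)

/-- `S : Fin r → Finset (Fin d)` is an ordered partition of `{0,…,d-1}`. -/
def OrdPart {d r : ℕ} (S : Fin r → Finset (Fin d)) : Prop :=
  (∀ j, (S j).Nonempty) ∧ (∀ j k, j ≠ k → Disjoint (S j) (S k)) ∧
    Finset.univ.biUnion S = (Finset.univ : Finset (Fin d))

/-- `S` is the limiting partition of the stable sequence `w`. -/
def LimPart {d r : ℕ} (w : ℕ → Fin d → ℝ) (S : Fin r → Finset (Fin d)) : Prop :=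
  OrdPart S ∧
  (∀ i j : Fin d, (∃ a, i ∈ S a ∧ j ∈ S a) ↔
      ∃ L : ℝ, 0 < L ∧ Tendsto (fun n => w n i / w n j) atTop (𝓝 L)) ∧
  (∀ a b : Fin r, a < b → ∀ i ∈ S a, ∀ j ∈ S b,
      Tendsto (fun n => w n i / w n j) atTop atTop)

/-- The constant `C_i^T = ∏_{t ∈ T} (λ_t − λ_i)²`. -/
def Cc {d : ℕ} (lam : Fin d → ℝ) (i : Fin d) (T : Finset (Fin d)) : ℝ :=
  ∏ t ∈ T, (lam t - lam i) ^ 2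

/-- Offset `∑_{k<j} |S_k|` of the `j`-th block. -/
def offS {d r : ℕ} (S : Fin r → Finset (Fin d)) (j : Fin r) : ℕ :=
  ∑ k ∈ Finset.univ.filter (· < j), (S k).card

/-- The block-diagonal matrix whose `j`-th block (in rows/columns
`offS S j, …, offS S j + |S_j| - 1`) is `Jmat (restr (S j) lam) (restr (S j) (v j))`. -/
def blockDiag {d r : ℕ} (lam : Fin d → ℝ) (S : Fin r → Finset (Fin d))
    (v : Fin r → Fin d → ℝ) : Matrix (Fin d) (Fin d) ℝ :=
  Matrix.of fun p q =>
    ∑ j : Fin r,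
      if h : offS S j ≤ (p : ℕ) ∧ (p : ℕ) < offS S j + (S j).card ∧
          offS S j ≤ (q : ℕ) ∧ (q : ℕ) < offS S j + (S j).card then
        Jmat (restr (S j) lam) (restr (S j) (v j))
          ⟨(p : ℕ) - offS S j, by omega⟩ ⟨(q : ℕ) - offS S j, by omega⟩
      else 0

/-- Nonempty subsets of `Fin d`. -/
abbrev NES (d : ℕ) := {S : Finset (Fin d) // S.Nonempty}

/-- The ambient Euclidean space of families `(w^S)` indexed by nonempty subsets. -/
abbrev Ew (d : ℕ) := NES d → Fin d → ℝ

/-- The blow-up `B` (normalized representatives): support, nonnegativity,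
normalization, and the quadratic equations. -/
def Bset {d : ℕ} (lam : Fin d → ℝ) : Set (Ew d) :=
  {w | (∀ S : NES d, ∀ n, n ∉ S.1 → w S n = 0) ∧
    (∀ S n, 0 ≤ w S n) ∧
    (∀ S : NES d, ∑ n ∈ S.1, w S n = 1) ∧
    ∀ R S : NES d, R.1 ⊆ S.1 → ∀ i ∈ R.1, ∀ j ∈ R.1,
      Cc lam i (S.1 \ R.1) * w R j * w S i = Cc lam j (S.1 \ R.1) * w R i * w S j}

/-- `𝒥̄^Λ`: symmetric tridiagonal matrices with nonnegative off-diagonal entries and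
characteristic polynomial `∏ (X − λ_k)`. -/
def Jset {d : ℕ} (lam : Fin d → ℝ) : Set (Matrix (Fin d) (Fin d) ℝ) :=
  {J | (∀ i j, J i j = J j i) ∧
    (∀ i j : Fin d, (i : ℕ) + 2 ≤ (j : ℕ) ∨ (j : ℕ) + 2 ≤ (i : ℕ) → J i j = 0) ∧
    (∀ i j : Fin d, (i : ℕ) + 1 = (j : ℕ) → 0 ≤ J i j) ∧
    J.charpoly = ∏ k, (X - C (lam k))}

/-- `K_j = S_j ∪ S_{j+1} ∪ … ∪ S_r`. -/
def Kof {d r : ℕ} (S : Fin r → Finset (Fin d)) (j : Fin r) : Finset (Fin d) :=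
  (Finset.univ.filter (j ≤ ·)).biUnion S

/-- The piece `Z(P)` of `B` corresponding to the ordered partition `P = (S_1,…,S_r)`:
for every nonempty `T`, the support of `w^T` is `T ∩ S_{i(T,P)}`. -/
def Zset {d : ℕ} (lam : Fin d → ℝ) {r : ℕ} (S : Fin r → Finset (Fin d)) : Set (Ew d) :=
  {w | w ∈ Bset lam ∧ ∀ T : NES d, ∃ j : Fin r, T.1 ⊆ Kof S j ∧
    (∀ k, T.1 ⊆ Kof S k → k ≤ j) ∧ ∀ n : Fin d, w T n ≠ 0 ↔ n ∈ T.1 ∧ n ∈ S j}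

/-- `R ⪯ S`: the ordered partition `R` refines `S`, i.e. `R` is the concatenation of
ordered partitions of `S_1`, then `S_2`, etc. -/
def Refines {d q r : ℕ} (R : Fin q → Finset (Fin d)) (S : Fin r → Finset (Fin d)) : Prop :=
  ∃ b : Fin (r + 1) → ℕ, b 0 = 0 ∧ b (Fin.last r) = q ∧
    (∀ i j : Fin (r + 1), i ≤ j → b i ≤ b j) ∧
    ∀ i : Fin r, S i = (Finset.univ.filter
      (fun k : Fin q => b i.castSucc ≤ (k : ℕ) ∧ (k : ℕ) < b i.succ)).biUnion R

/-- The `j`-th consecutive interval `I_j(T)` of lengths `|T_1|,…,|T_r|`. -/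
def Iint {d r : ℕ} (T : Fin r → Finset (Fin d)) (j : Fin r) : Finset (Fin d) :=
  Finset.univ.filter (fun m : Fin d => offS T j ≤ (m : ℕ) ∧ (m : ℕ) < offS T j + (T j).card)

/-- `H(T) = {σ : σ(T_j) = I_j(T) for all j}`. -/
def Hset {d r : ℕ} (T : Fin r → Finset (Fin d)) : Set (Equiv.Perm (Fin d)) :=
  {σ | ∀ j, (T j).image σ = Iint T j}

/-- Interval Young subgroups: setwise stabilizers of a division of `{0,…,d-1}` into
consecutive intervals. -/
def IsIntervalYoung {d : ℕ} (G : Set (Equiv.Perm (Fin d))) : Prop :=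
  ∃ (q : ℕ) (c : Fin q → Finset (Fin d)), OrdPart c ∧ (∀ j : Fin q, c j = Iint c j) ∧
    G = {τ : Equiv.Perm (Fin d) | ∀ j, (c j).image ⇑τ = c j}

/-- Number of surjections from an `a`-element set onto a `b`-element set. -/
def Surj (a b : ℕ) : ℕ := Fintype.card {f : Fin a → Fin b // Function.Surjective f}

/-- The Euler characteristic `χ_d = ∑_{q=1}^d (−2)^{d−q}·Surj(d,q)`. -/
def chi (a : ℕ) : ℝ := ∑ q ∈ Finset.Icc 1 a, (-2 : ℝ) ^ (a - q) * (Surj a q : ℝ)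
theorem ip_comm {m : ℕ} (μ v : Fin m → ℝ) (p q : ℝ[X]) : ip μ v p q = ip μ v q p := by
  simp only [ip, mul_comm (p.eval _)]

theorem ip_add_right {m : ℕ} (μ v : Fin m → ℝ) (p q r : ℝ[X]) :
    ip μ v p (q + r) = ip μ v p q + ip μ v p r := by
  simp only [ip, eval_add, ← Finset.sum_add_distrib]
  exact Finset.sum_congr rfl fun k _ => by ring

theorem ip_sub_left {m : ℕ} (μ v : Fin m → ℝ) (p q r : ℝ[X]) :
    ip μ v (p - q) r = ip μ v p r - ip μ v q r := by
  simp only [ip, eval_sub, ← Finset.sum_sub_distrib]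
  exact Finset.sum_congr rfl fun k _ => by ring

theorem ip_C_mul_left {m : ℕ} (μ v : Fin m → ℝ) (c : ℝ) (p q : ℝ[X]) :
    ip μ v (C c * p) q = c * ip μ v p q := by
  simp only [ip, eval_mul, eval_C, Finset.mul_sum]
  exact Finset.sum_congr rfl fun k _ => by ring

theorem ip_C_mul_right {m : ℕ} (μ v : Fin m → ℝ) (c : ℝ) (p q : ℝ[X]) :
    ip μ v p (C c * q) = c * ip μ v p q := by
  rw [ip_comm, ip_C_mul_left, ip_comm]

theorem ip_X_mul_left {m : ℕ} (μ v : Fin m → ℝ) (p q : ℝ[X]) :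
    ip μ v (X * p) q = ip μ v p (X * q) := by
  simp only [ip, eval_mul, eval_X]
  exact Finset.sum_congr rfl fun k _ => by ring

theorem op_zero {m : ℕ} (μ v : Fin m → ℝ) : op μ v 0 = 1 := rfl

theorem op_one {m : ℕ} (μ v : Fin m → ℝ) :
    op μ v 1 = (X - C (ip μ v (op μ v 0) (X * op μ v 0) / ip μ v (op μ v 0) (op μ v 0))) *
      op μ v 0 := by
  simp [op, opAux]

theorem op_add_two {m : ℕ} (μ v : Fin m → ℝ) (n : ℕ) :
    op μ v (n + 2) =
      (X - C (ip μ v (op μ v (n + 1)) (X * op μ v (n + 1)) /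
          ip μ v (op μ v (n + 1)) (op μ v (n + 1)))) * op μ v (n + 1)
        - C (ip μ v (op μ v (n + 1)) (op μ v (n + 1)) / ip μ v (op μ v n) (op μ v n)) *
          op μ v n := rfl

theorem op_monic_and_natDegree {m : ℕ} (μ v : Fin m → ℝ) (n : ℕ) :
    (op μ v n).Monic ∧ (op μ v n).natDegree = n := by
  induction n using Nat.twoStepInduction with
  | zero => simp [op_zero]
  | one => rw [op_one, op_zero, mul_one]; exact ⟨monic_X_sub_C _, natDegree_X_sub_C _⟩
  | more n ih₀ ih₁ =>
    rw [op_add_two]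
    set a := ip μ v (op μ v (n + 1)) (X * op μ v (n + 1)) /
      ip μ v (op μ v (n + 1)) (op μ v (n + 1))
    set b := ip μ v (op μ v (n + 1)) (op μ v (n + 1)) / ip μ v (op μ v n) (op μ v n)
    have hM : ((X - C a) * op μ v (n + 1)).Monic := (monic_X_sub_C a).mul ih₁.1
    have hD : ((X - C a) * op μ v (n + 1)).natDegree = n + 2 := by
      rw [(monic_X_sub_C a).natDegree_mul ih₁.1, natDegree_X_sub_C, ih₁.2]; omega
    have hlt : (C b * op μ v n).natDegree < ((X - C a) * op μ v (n + 1)).natDegree := by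
      have := natDegree_C_mul_le b (op μ v n)
      omega
    exact ⟨hM.sub_of_left (degree_lt_degree hlt),
      by rw [natDegree_sub_eq_left_of_natDegree_lt hlt, hD]⟩

theorem op_monic {m : ℕ} (μ v : Fin m → ℝ) (n : ℕ) : (op μ v n).Monic :=
  (op_monic_and_natDegree μ v n).1

theorem natDegree_op {m : ℕ} (μ v : Fin m → ℝ) (n : ℕ) : (op μ v n).natDegree = n :=
  (op_monic_and_natDegree μ v n).2

theorem coeff_op_self {m : ℕ} (μ v : Fin m → ℝ) (n : ℕ) : (op μ v n).coeff n = 1 := by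
  have h := op_monic μ v n
  rwa [Monic, leadingCoeff, natDegree_op] at h

theorem ip_self_pos {m : ℕ} {μ v : Fin m → ℝ} (hμ : Function.Injective μ) (hv : ∀ k, 0 < v k)
    {p : ℝ[X]} (hp : p ≠ 0) (hdeg : p.natDegree < m) : 0 < ip μ v p p := by
  obtain ⟨k, hk⟩ : ∃ k, p.eval (μ k) ≠ 0 := by
    by_contra! h
    refine hp (eq_zero_of_natDegree_lt_card_of_eval_eq_zero p hμ h ?_)
    simpa using hdeg
  refine Finset.sum_pos' (fun j _ => mul_nonneg (mul_self_nonneg _) (hv j).le)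
    ⟨k, Finset.mem_univ k, mul_pos (mul_self_pos.2 hk) (hv k)⟩

theorem ip_op_self_pos {m : ℕ} {μ v : Fin m → ℝ} (hμ : Function.Injective μ)
    (hv : ∀ k, 0 < v k) {n : ℕ} (hn : n < m) : 0 < ip μ v (op μ v n) (op μ v n) :=
  ip_self_pos hμ hv (op_monic μ v n).ne_zero (by rwa [natDegree_op])

/-- Subtracting the multiple of `op μ v (n + 1)` with the same leading coefficient lowers the
degree. -/
theorem exists_eq_C_mul_op_add {m : ℕ} (μ v : Fin m → ℝ) {n : ℕ} {q : ℝ[X]}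
    (hq : q.natDegree ≤ n + 1) :
    ∃ r : ℝ[X], r.natDegree ≤ n ∧ q = C (q.coeff (n + 1)) * op μ v (n + 1) + r := by
  refine ⟨q - C (q.coeff (n + 1)) * op μ v (n + 1), ?_, by ring⟩
  rw [natDegree_le_iff_coeff_eq_zero]
  intro N hN
  rw [coeff_sub, coeff_C_mul]
  rcases eq_or_lt_of_le (Nat.succ_le_of_lt hN) with h | h
  · rw [← h, Nat.succ_eq_add_one, coeff_op_self]; ring
  · rw [coeff_eq_zero_of_natDegree_lt (by omega : q.natDegree < N),
      coeff_eq_zero_of_natDegree_lt (by rw [natDegree_op]; omega : (op μ v (n + 1)).natDegree < N)]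
    ring

/-- If `op μ v (n + 1)` is orthogonal to all polynomials of degree at most `n`, its pairing with
a polynomial of degree at most `n + 1` only sees the leading coefficient. -/
theorem ip_op_succ_of_orthogonal {m : ℕ} {μ v : Fin m → ℝ} {n : ℕ}
    (h : ∀ r : ℝ[X], r.natDegree ≤ n → ip μ v (op μ v (n + 1)) r = 0)
    {q : ℝ[X]} (hq : q.natDegree ≤ n + 1) :
    ip μ v (op μ v (n + 1)) q =
      q.coeff (n + 1) * ip μ v (op μ v (n + 1)) (op μ v (n + 1)) := by
  obtain ⟨r, hr, hqr⟩ := exists_eq_C_mul_op_add μ v hq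
  conv_lhs => rw [hqr]
  rw [ip_add_right, ip_C_mul_right, h r hr, add_zero]

/-- Pairing `op μ v n` with a polynomial of degree at most `n` only sees the coefficient of
degree `n`. -/
theorem ip_op_eq_coeff_mul {m : ℕ} {μ v : Fin m → ℝ} (hμ : Function.Injective μ)
    (hv : ∀ k, 0 < v k) {n : ℕ} (hn : n ≤ m) {q : ℝ[X]} (hq : q.natDegree ≤ n) :
    ip μ v (op μ v n) q = q.coeff n * ip μ v (op μ v n) (op μ v n) := by
  induction n using Nat.twoStepInduction generalizing q with
  | zero =>
    conv_lhs => rw [eq_C_of_natDegree_le_zero hq, ← mul_one (C (q.coeff 0)), ip_C_mul_right]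
    rw [op_zero]
  | one =>
    refine ip_op_succ_of_orthogonal (fun r hr => ?_) hq
    have h0 := (ip_op_self_pos hμ hv (by omega : 0 < m)).ne'
    rw [eq_C_of_natDegree_le_zero hr, ← mul_one (C (r.coeff 0)), ip_C_mul_right, ← op_zero μ v,
      zero_add, op_one, sub_mul, ip_sub_left, ip_C_mul_left, ip_X_mul_left, div_mul_cancel₀ _ h0,
      sub_self, mul_zero]
  | more n ih₀ ih₁ =>
    refine ip_op_succ_of_orthogonal (fun r hr => ?_) hq
    have h0 := (ip_op_self_pos hμ hv (by omega : n < m)).ne'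
    have h1 := (ip_op_self_pos hμ hv (by omega : n + 1 < m)).ne'
    have horth : ∀ s : ℝ[X], s.natDegree ≤ n → ip μ v (op μ v (n + 1)) s = 0 := fun s hs => by
      rw [ih₁ (by omega) (by omega), coeff_eq_zero_of_natDegree_lt (by omega), zero_mul]
    obtain ⟨s, hs, hrs⟩ := exists_eq_C_mul_op_add μ v hr
    have hXs : (X * s).natDegree ≤ n + 1 := by
      have := natDegree_mul_le (p := (X : ℝ[X])) (q := s)
      rw [natDegree_X] at this
      omega
    have hs0 : ip μ v (op μ v (n + 2)) s = 0 := by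
      rw [op_add_two, sub_mul, ip_sub_left, ip_sub_left, ip_C_mul_left, ip_C_mul_left,
        ip_X_mul_left, horth s hs, ih₁ (by omega) hXs, ih₀ (by omega) hs, coeff_X_mul]
      field_simp
      ring
    have hp0 : ip μ v (op μ v (n + 2)) (op μ v (n + 1)) = 0 := by
      rw [op_add_two, sub_mul, ip_sub_left, ip_sub_left, ip_C_mul_left, ip_C_mul_left,
        ip_X_mul_left, ip_comm μ v (op μ v n) (op μ v (n + 1)), horth _ (natDegree_op μ v n).le]
      field_simp
      ring
    change ip μ v (op μ v (n + 2)) r = 0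
    rw [hrs, ip_add_right, ip_C_mul_right, hs0, hp0]
    ring

/-- Pairing with the nodal polynomial that omits `k` evaluates at the `k`-th node. -/
theorem ip_nodal_erase {m : ℕ} (μ v : Fin m → ℝ) (p : ℝ[X]) (k : Fin m) :
    ip μ v p (Lagrange.nodal (Finset.univ.erase k) μ) =
      p.eval (μ k) * (derivative (∏ j, (X - C (μ j)))).eval (μ k) * v k := by
  have hk := Lagrange.eval_nodal_derivative_eval_node_eq (v := μ) (Finset.mem_univ k)
  rw [Lagrange.nodal_eq Finset.univ] at hk
  rw [hk, ip]
  refine Finset.sum_eq_single k (fun j _ hj => ?_) (fun h => absurd (Finset.mem_univ k) h)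
  rw [Lagrange.eval_nodal_at_node (Finset.mem_erase.2 ⟨hj, Finset.mem_univ j⟩)]
  ring

theorem natDegree_nodal_erase {n : ℕ} (μ : Fin (n + 1) → ℝ) (k : Fin (n + 1)) :
    (Lagrange.nodal (Finset.univ.erase k) μ).natDegree = n := by
  rw [Lagrange.natDegree_nodal, Finset.card_erase_of_mem (Finset.mem_univ k), Finset.card_univ,
    Fintype.card_fin, Nat.add_sub_cancel]

theorem eval_derivative_nodal_ne_zero {m : ℕ} {μ : Fin m → ℝ} (hμ : Function.Injective μ)
    (k : Fin m) : (derivative (∏ j, (X - C (μ j)))).eval (μ k) ≠ 0 := by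
  have hk := Lagrange.eval_nodal_derivative_eval_node_eq (v := μ) (Finset.mem_univ k)
  rw [Lagrange.nodal_eq Finset.univ] at hk
  rw [hk]
  exact Lagrange.eval_nodal_not_at_node fun j hj h => Finset.ne_of_mem_erase hj (hμ h).symm

theorem eval_op_last_mul {n : ℕ} {μ v : Fin (n + 1) → ℝ} (hμ : Function.Injective μ)
    (hv : ∀ k, 0 < v k) (k : Fin (n + 1)) :
    (op μ v n).eval (μ k) * (derivative (∏ j, (X - C (μ j)))).eval (μ k) * v k =
      ip μ v (op μ v n) (op μ v n) := by
  have hdeg := natDegree_nodal_erase μ k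
  have hmon : (Lagrange.nodal (Finset.univ.erase k) μ).Monic := Lagrange.nodal_monic
  rw [Monic, leadingCoeff, hdeg] at hmon
  rw [← ip_nodal_erase, ip_op_eq_coeff_mul hμ hv n.le_succ hdeg.le, hmon, one_mul]

theorem eval_op_card {n : ℕ} {μ v : Fin (n + 1) → ℝ} (hμ : Function.Injective μ)
    (hv : ∀ k, 0 < v k) (k : Fin (n + 1)) : (op μ v (n + 1)).eval (μ k) = 0 := by
  have hdeg := natDegree_nodal_erase μ k
  have h := ip_nodal_erase μ v (op μ v (n + 1)) k
  rw [ip_op_eq_coeff_mul hμ hv le_rfl (by omega), coeff_eq_zero_of_natDegree_lt (by omega),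
    zero_mul] at h
  simpa [eval_derivative_nodal_ne_zero hμ k, (hv k).ne'] using h.symm

section DualWeights

variable {N : ℕ} {lam w v : Fin (N + 1) → ℝ}

theorem ip_dual (hlam : Function.Injective lam) (hw : ∀ k, 0 < w k)
    (hv : ∀ k, v k = 1 / ((derivative (∏ j, (X - C (lam j)))).eval (lam k) ^ 2 * w k))
    {p q : ℝ[X]} {c : ℝ}
    (h : ∀ k, q.eval (lam k) =
      p.eval (lam k) * (derivative (∏ j, (X - C (lam j)))).eval (lam k) * w k / c) :
    ip lam v q q = ip lam w p p / c ^ 2 ∧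
      ip lam v q (X * q) = ip lam w p (X * p) / c ^ 2 := by
  simp only [ip, eval_mul, eval_X, Finset.sum_div]
  constructor <;>
  · refine Finset.sum_congr rfl fun k _ => ?_
    have h1 := eval_derivative_nodal_ne_zero hlam k
    have h2 := (hw k).ne'
    rw [h, hv]
    field_simp

/-- The values of the orthogonal polynomials for the dual weights. -/
theorem eval_op_dual (hlam : Function.Injective lam) (hw : ∀ k, 0 < w k)
    (hv : ∀ k, v k = 1 / ((derivative (∏ j, (X - C (lam j)))).eval (lam k) ^ 2 * w k))
    {n m : ℕ} (hnm : n + m = N) (k : Fin (N + 1)) :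
    (op lam v n).eval (lam k) =
      (op lam w m).eval (lam k) * (derivative (∏ j, (X - C (lam j)))).eval (lam k) * w k /
        ip lam w (op lam w m) (op lam w m) := by
  induction n using Nat.twoStepInduction generalizing m k with
  | zero =>
    obtain rfl : m = N := by omega
    rw [eval_op_last_mul hlam hw, div_self (ip_op_self_pos hlam hw m.lt_succ_self).ne', op_zero,
      eval_one]
  | one =>
    obtain rfl : N = m + 1 := by omega
    have h0 := (ip_op_self_pos hlam hw (by omega : m < m + 1 + 1)).ne'
    have h1 := (ip_op_self_pos hlam hw (by omega : m + 1 < m + 1 + 1)).ne'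
    have hq : ∀ k, (op lam v 0).eval (lam k) =
        (op lam w (m + 1)).eval (lam k) * (derivative (∏ j, (X - C (lam j)))).eval (lam k) * w k /
          ip lam w (op lam w (m + 1)) (op lam w (m + 1)) := fun k => by
      rw [op_zero, eval_one, eval_op_last_mul hlam hw k, div_self h1]
    have hrec := eval_op_card hlam hw k
    obtain ⟨hself, hX⟩ := ip_dual hlam hw hv hq
    rw [op_one, hself, hX, eval_mul, hq]
    rw [op_add_two] at hrec
    simp only [eval_sub, eval_mul, eval_X, eval_C] at hrec ⊢
    field_simp at hrec ⊢
    linear_combination (derivative (∏ j, (X - C (lam j)))).eval (lam k) * w k * hrec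
  | more n ih₀ ih₁ =>
    have h0 := (ip_op_self_pos hlam hw (by omega : m < N + 1)).ne'
    have h1 := (ip_op_self_pos hlam hw (by omega : m + 1 < N + 1)).ne'
    have h2 := (ip_op_self_pos hlam hw (by omega : m + 2 < N + 1)).ne'
    have hq₀ := ih₀ (m := m + 2) (by omega)
    have hq₁ := ih₁ (m := m + 1) (by omega)
    have hrec := congrArg (eval (lam k)) (op_add_two lam w m)
    obtain ⟨hself₀, -⟩ := ip_dual hlam hw hv hq₀
    obtain ⟨hself₁, hX₁⟩ := ip_dual hlam hw hv hq₁
    rw [op_add_two, hself₀, hself₁, hX₁]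
    simp only [eval_sub, eval_mul, eval_X, eval_C] at hrec ⊢
    rw [hq₀, hq₁, hrec]
    field_simp
    ring

theorem fEnt_odd_dual (hlam : Function.Injective lam) (hw : ∀ k, 0 < w k)
    (hv : ∀ k, v k = 1 / ((derivative (∏ j, (X - C (lam j)))).eval (lam k) ^ 2 * w k))
    {n m : ℕ} (hnm : n + m = N) : fEnt lam v (2 * n + 1) = fEnt lam w (2 * m + 1) := by
  have hm := (ip_op_self_pos hlam hw (by omega : m < N + 1)).ne'
  obtain ⟨hself, hX⟩ := ip_dual hlam hw hv (eval_op_dual hlam hw hv hnm)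
  have hn2 : (2 * n + 1) / 2 = n := by omega
  have hm2 : (2 * m + 1) / 2 = m := by omega
  rw [fEnt, fEnt, if_pos (by omega), if_pos (by omega), hn2, hm2, hself, hX]
  field_simp

theorem fEnt_even_dual (hlam : Function.Injective lam) (hw : ∀ k, 0 < w k)
    (hv : ∀ k, v k = 1 / ((derivative (∏ j, (X - C (lam j)))).eval (lam k) ^ 2 * w k))
    {n m : ℕ} (hnm : n + 1 + m = N) :
    fEnt lam v (2 * (n + 1)) = fEnt lam w (2 * (m + 1)) := by
  have h0 := (ip_op_self_pos hlam hw (by omega : m < N + 1)).ne'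
  have h1 := (ip_op_self_pos hlam hw (by omega : m + 1 < N + 1)).ne'
  obtain ⟨hself₁, -⟩ := ip_dual hlam hw hv (eval_op_dual hlam hw hv hnm)
  obtain ⟨hself₀, -⟩ := ip_dual hlam hw hv
    (eval_op_dual hlam hw hv (by omega : n + (m + 1) = N))
  rw [fEnt, fEnt, if_neg (by omega), if_neg (by omega), Nat.mul_div_cancel_left _ two_pos,
    Nat.mul_div_cancel_left _ two_pos, Nat.add_sub_cancel, Nat.add_sub_cancel, hself₀, hself₁]
  congr 1
  field_simp

end DualWeights

/-- Proposition 14: the flip transpose formula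
`f(λ, 1/(p′(λ_k)²·w_k)) = f(λ,w)^F`. -/
theorem stmt7 {d : ℕ} (hd : 1 ≤ d) (lam : Fin d → ℝ) (hlam : Function.Injective lam)
    (w v : Fin d → ℝ) (hw : ∀ k, 0 < w k)
    (hv : ∀ k, v k =
      1 / ((Polynomial.derivative (∏ j, (X - C (lam j)))).eval (lam k) ^ 2 * w k)) :
    ∀ i j : Fin d, Jmat lam v i j = Jmat lam w j.rev i.rev := by
  obtain ⟨N, rfl⟩ := Nat.exists_eq_add_of_le' hd
  intro i j
  have hi := i.isLt
  have hj := j.isLt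
  simp only [Jmat, Matrix.of_apply, Fin.rev_inj, Fin.val_rev]
  by_cases hij : i = j
  · subst hij
    rw [if_pos rfl, if_pos rfl]
    exact fEnt_odd_dual hlam hw hv (by omega)
  rw [if_neg hij, if_neg (Ne.symm hij)]
  by_cases hadj : (i : ℕ) + 1 = j ∨ (j : ℕ) + 1 = i
  · rw [if_pos hadj, if_pos (by omega)]
    obtain ⟨n, hn⟩ : ∃ n, (i : ℕ) + j + 1 = 2 * (n + 1) := ⟨min (i : ℕ) j, by omega⟩
    have hm : N + 1 - ((j : ℕ) + 1) + (N + 1 - ((i : ℕ) + 1)) + 1 = 2 * (N - 1 - n + 1) := by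
      omega
    rw [hn, hm]
    exact fEnt_even_dual hlam hw hv (by omega)
  · rw [if_neg hadj, if_neg (by omega)]
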